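/- Let p be an odd prime, G a finite group, H a subgroup of G, and P a Sylow p-subgroup of G with P ≤ H (so P is also a Sylow p-subgroup of H). Suppose that H controls p-fusion in G on elementary abelian p-subgroups: for every elementary abelian p-subgroup E ≤ P and every g ∈ G with gEg⁻¹ ≤ P, there exists h ∈ H such that hxh⁻¹ = gxg⁻¹ for all x ∈ E. Then H controls p-fusion in G on all subgroups: for every subgroup Q ≤ P and every g ∈ G with gQg⁻¹ ≤ P, there exists h ∈ H such that hxh⁻¹ = gxg⁻¹ for all x ∈ Q. -/

import Mathlib

/-!
Group-realized case of Theorem B of Benson–Grodal–Henke (valid for `p` odd): control of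
`p`-fusion on elementary abelian `p`-subgroups implies control of `p`-fusion on all
subgroups.  This is the key fusion-system ingredient in the paper's proof of Mislin's
theorem for saturated fusion systems.
-/

/-- A subgroup `E` of `G` is elementary abelian (for the prime `p`) if it is abelian and
every element `x ∈ E` satisfies `x ^ p = 1`. -/
def Subgroup.IsElementaryAbelian {G : Type*} [Group G] (p : ℕ) (E : Subgroup G) : Prop :=
  (∀ x ∈ E, ∀ y ∈ E, x * y = y * x) ∧ (∀ x ∈ E, x ^ p = 1)

theorem mul_pow_of_commutator_central {G : Type*} [Group G] {a b d : G}
    (hba : b * a = a * b * d) (hda : Commute d a) (hdb : Commute d b) (n : ℕ) :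
    (a * b) ^ n = a ^ n * b ^ n * d ^ (n.choose 2) := by
  have key : ∀ n : ℕ, b ^ n * a = a * b ^ n * d ^ n := by
    intro n
    induction n with
    | zero => simp
    | succ n ih =>
      calc b ^ (n + 1) * a = b ^ n * (b * a) := by rw [pow_succ, mul_assoc]
        _ = (b ^ n * a) * (b * d) := by rw [hba]; simp only [mul_assoc]
        _ = a * b ^ n * (d ^ n * b) * d := by rw [ih]; simp only [mul_assoc]
        _ = a * b ^ (n + 1) * d ^ (n + 1) := by
          rw [(hdb.pow_left n).eq, pow_succ, pow_succ]; simp only [mul_assoc]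
  induction n with
  | zero => simp
  | succ n ih =>
    have h1 : Commute (d ^ n.choose 2) (a * b) := (hda.mul_right hdb).pow_left _
    have h2 : Commute (d ^ n) b := hdb.pow_left n
    calc (a * b) ^ (n + 1) = a ^ n * b ^ n * (d ^ n.choose 2 * (a * b)) := by
          rw [pow_succ, ih, mul_assoc]
      _ = a ^ n * (b ^ n * a) * b * d ^ n.choose 2 := by rw [h1.eq]; simp only [mul_assoc]
      _ = a ^ n * a * b ^ n * (d ^ n * b) * d ^ n.choose 2 := by
          rw [key]; simp only [mul_assoc]
      _ = a ^ (n + 1) * b ^ (n + 1) * d ^ (n + 1).choose 2 := by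
          rw [h2.eq, Nat.choose_succ_succ' n 1, Nat.choose_one_right, pow_add d, pow_succ a,
            pow_succ b]
          simp only [mul_assoc]

/-- In a finite `p`-group with `p` odd, if the elements of exponent `p` of a normal subgroup `U`
are central, then two elements of the same coset of `U` with the same `p`-th power differ by an
element of exponent `p`. -/
theorem IsPGroup.inv_mul_pow_eq_one {p : ℕ} [Fact p.Prime] (hp : Odd p)
    {D : Type*} [Group D] [Finite D] (hD : IsPGroup p D) (U : Subgroup D) [U.Normal]
    (hU : ∀ u ∈ U, u ^ p = 1 → ∀ d, Commute u d)
    {x y : D} (hxyU : x⁻¹ * y ∈ U) (hxy : x ^ p = y ^ p) : (x⁻¹ * y) ^ p = 1 := by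
  induction hn : Nat.card D using Nat.strong_induction_on generalizing D with
  | _ n ih =>
  subst hn
  by_cases hx : Subgroup.zpowers x = ⊤
  · obtain ⟨k, rfl⟩ := Subgroup.mem_zpowers_iff.1 (hx ▸ Subgroup.mem_top y)
    rw [((Commute.refl x).inv_left.zpow_right k).mul_pow, ← hxy, inv_pow, inv_mul_cancel]
  obtain ⟨M, hM, hxM⟩ := (eq_top_or_exists_le_coatom (Subgroup.zpowers x)).resolve_left hx
  rw [Subgroup.zpowers_le] at hxM
  have := hD.isNilpotent
  have hMn : M.Normal :=
    Subgroup.NormalizerCondition.normal_of_coatom M Group.normalizerCondition_of_isNilpotent hM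
  set d := y⁻¹ * x * y * x⁻¹ with hd
  have hdU : d ∈ U := by
    have h1 := U.mul_mem (U.inv_mem hxyU) (‹U.Normal›.conj_mem _ hxyU x)
    convert h1 using 1
    rw [hd]; group
  have hX : y⁻¹ * x⁻¹ * y ∈ M := by simpa using hMn.conj_mem _ (M.inv_mem hxM) y⁻¹
  have hdp : d ^ p = 1 := by
    have h1 := @ih (Nat.card M) (not_le.1 fun h => hM.1 (Subgroup.eq_top_of_le_card M h))
      M _ _ (hD.to_subgroup M) (U.subgroupOf M) _ (fun u hu hup e => by
        have := hU u hu (by simpa using congrArg Subtype.val hup) e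
        exact Subtype.ext this) ⟨y⁻¹ * x⁻¹ * y, hX⟩ ⟨x⁻¹, M.inv_mem hxM⟩
      (by
        rw [Subgroup.mem_subgroupOf]
        convert hdU using 1
        simp [hd, mul_assoc])
      (by
        apply Subtype.ext
        have : y⁻¹ * x⁻¹ * y = y⁻¹ * x⁻¹ * y⁻¹⁻¹ := by simp
        simp only [SubmonoidClass.mk_pow]
        rw [this, conj_pow, inv_pow, hxy]
        group)
      rfl
    have h2 := congrArg Subtype.val h1
    simpa [hd, mul_assoc] using h2
  have hc := hU d hdU hdp
  rw [mul_pow_of_commutator_central (d := d) (by rw [hd]; group) (hc _) (hc _), inv_pow, hxy,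
    inv_mul_cancel, one_mul]
  obtain ⟨k, hk⟩ := hp
  have : p.choose 2 = p * k := by
    rw [Nat.choose_two_right]
    have : p * (p - 1) = p * k * 2 := by rw [hk]; simp; ring
    omega
  rw [this, pow_mul, hdp, one_pow]

open scoped commutatorElement in
theorem IsPGroup.exists_mem_notMem_commutator_mem {p : ℕ} [Fact p.Prime]
    {P : Type*} [Group P] [Finite P] (hP : IsPGroup p P) {C U : Subgroup P} [C.Normal]
    (hCU : ¬ C ≤ U) : ∃ w ∈ C, w ∉ U ∧ ∀ t, ⁅w, t⁆ ∈ U := by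
  classical
  have := hP.isNilpotent
  obtain ⟨n, hn⟩ := Subgroup.nilpotent_iff_lowerCentralSeries.1 this
  have hex : ∃ n, C ⊓ (⊤ : Subgroup P).lowerCentralSeries n ≤ U := ⟨n, by simp [hn]⟩
  have hm := Nat.find_spec hex
  rcases hk : Nat.find hex with _ | m
  · rw [hk] at hm
    simp [hCU] at hm
  · rw [hk] at hm
    have hmin := Nat.find_min hex (m := m) (by omega)
    obtain ⟨w, ⟨hwC, hw⟩, hwU⟩ := SetLike.not_le_iff_exists.1 hmin
    refine ⟨w, hwC, hwU, fun t => hm ⟨?_, ?_⟩⟩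
    · rw [commutatorElement_def, mul_assoc, mul_assoc, ← mul_assoc t]
      exact C.mul_mem hwC (‹C.Normal›.conj_mem _ (C.inv_mem hwC) t)
    · exact Subgroup.commutator_mem_commutator hw (Subgroup.mem_top t)

open scoped commutatorElement in
/-- A normal subgroup `Q` of a finite `p`-group, `p` odd, contains an elementary abelian normal
subgroup which contains every element of exponent `p` of its centralizer in `Q`. -/
theorem IsPGroup.exists_isElementaryAbelian_normal {p : ℕ} [Fact p.Prime] (hp : Odd p)
    {P : Type*} [Group P] [Finite P] (hP : IsPGroup p P) (Q : Subgroup P) [Q.Normal] :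
    ∃ A ≤ Q, A.Normal ∧ A.IsElementaryAbelian p ∧
      ∀ x ∈ Q, x ∈ Subgroup.centralizer (A : Set P) → x ^ p = 1 → x ∈ A := by
  obtain ⟨A, ⟨hAQ, hAn, hA⟩, hAmax⟩ := Set.Finite.exists_maximal
    (s := {A : Subgroup P | A ≤ Q ∧ A.Normal ∧ A.IsElementaryAbelian p}) (Set.toFinite _)
    ⟨⊥, bot_le, inferInstance, by simp [Subgroup.IsElementaryAbelian]⟩
  refine ⟨A, hAQ, hAn, hA, ?_⟩
  set C : Subgroup P := Q ⊓ Subgroup.centralizer (A : Set P) with hC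
  have hCn : C.Normal := inferInstance
  have hAC : A ≤ C := le_inf hAQ fun a ha =>
    Subgroup.mem_centralizer_iff.2 fun b hb => hA.1 b hb a ha
  obtain ⟨U, ⟨hAU, hUC, hUn, hUA⟩, hUmax⟩ := Set.Finite.exists_maximal
    (s := {U : Subgroup P | A ≤ U ∧ U ≤ C ∧ U.Normal ∧ ∀ x ∈ U, x ^ p = 1 → x ∈ A})
    (Set.toFinite _) ⟨A, le_rfl, hAC, hAn, fun x hx _ => hx⟩
  by_cases hCU : C ≤ U
  · exact fun x hx hxA => hUA x (hCU ⟨hx, hxA⟩)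
  exfalso
  obtain ⟨w, hwC, hwU, hw⟩ := hP.exists_mem_notMem_commutator_mem hCU
  set D : Subgroup P := C ⊓ (Subgroup.center (P ⧸ U)).comap (QuotientGroup.mk' U) with hD
  have hmemD : ∀ x, x ∈ D ↔ x ∈ C ∧ ∀ t, ⁅x, t⁆ ∈ U := by
    intro x
    rw [hD, Subgroup.mem_inf, Subgroup.mem_comap, Subgroup.mem_center_iff]
    refine and_congr_right fun _ => ⟨fun h t => ?_, fun h t => ?_⟩
    · rw [← QuotientGroup.eq_one_iff]
      have := h (t : P ⧸ U)
      simp only [QuotientGroup.mk'_apply] at this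
      rw [← QuotientGroup.mk'_apply, map_commutatorElement]
      exact commutatorElement_eq_one_iff_mul_comm.2 this.symm
    · obtain ⟨t, rfl⟩ := QuotientGroup.mk'_surjective U t
      have := (QuotientGroup.eq_one_iff _).2 (h t)
      rw [← QuotientGroup.mk'_apply, map_commutatorElement] at this
      exact (commutatorElement_eq_one_iff_mul_comm.1 this).symm
  have hDn : D.Normal := inferInstance
  have hUD : U ≤ D := fun u hu => (hmemD u).2 ⟨hUC hu, fun t => by
    rw [commutatorElement_def, mul_assoc, mul_assoc, ← mul_assoc t]
    exact U.mul_mem hu (hUn.conj_mem _ (U.inv_mem hu) t)⟩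
  obtain ⟨x, hxD, hxp, hxA⟩ : ∃ x ∈ D, x ^ p = 1 ∧ x ∉ A := by
    by_contra! h
    exact hwU (hUmax ⟨hAU.trans hUD, inf_le_left, hDn, h⟩ hUD ((hmemD w).2 ⟨hwC, hw⟩))
  obtain ⟨hxC, hxU⟩ := (hmemD x).1 hxD
  have hcomm : ∀ a ∈ A, ∀ c ∈ C, Commute a c := fun a ha c hc =>
    Subgroup.mem_centralizer_iff.1 hc.2 a ha
  have hxt : ∀ t : P, ∃ a ∈ A, t * x * t⁻¹ = x * a := by
    intro t
    have htC : t * x * t⁻¹ ∈ C := hCn.conj_mem x hxC t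
    have hU' : x⁻¹ * (t * x * t⁻¹) ∈ U := by
      convert hUn.conj_mem _ (U.inv_mem (hxU t)) x⁻¹ using 1
      rw [commutatorElement_def]; group
    refine ⟨x⁻¹ * (t * x * t⁻¹), hUA _ hU' ?_, by simp⟩
    have := (hP.to_subgroup C).inv_mul_pow_eq_one hp (U.subgroupOf C)
      (fun u hu hup d => Subtype.ext
        (hcomm u (hUA u hu (by simpa using congrArg Subtype.val hup)) d d.2))
      (x := ⟨x, hxC⟩) (y := ⟨_, htC⟩) hU' (Subtype.ext (by simp [conj_pow, hxp]))
    simpa using congrArg Subtype.val this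
  have hmem : ∀ y, y ∈ A ⊔ Subgroup.zpowers x ↔ ∃ a ∈ A, ∃ k : ℤ, a * x ^ k = y := fun y => by
    simp [Subgroup.mem_sup_of_normal_left, Subgroup.mem_zpowers_iff]
  have hax : ∀ a ∈ A, ∀ k : ℤ, Commute a (x ^ k) := fun a ha k => (hcomm a ha x hxC).zpow_right k
  refine hxA (hAmax (y := A ⊔ Subgroup.zpowers x) ⟨?_, ⟨?_⟩, ?_, ?_⟩ le_sup_left
    (Subgroup.mem_sup_right (Subgroup.mem_zpowers x)))
  · exact sup_le hAQ (by simpa using hxC.1)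
  · intro y hy t
    obtain ⟨a, ha, k, rfl⟩ := (hmem y).1 hy
    obtain ⟨b, hb, hbx⟩ := hxt t
    rw [← conj_mul, ← conj_zpow, hbx]
    refine mul_mem (Subgroup.mem_sup_left (hAn.conj_mem a ha t)) (zpow_mem (mul_mem ?_ ?_) k)
    · exact Subgroup.mem_sup_right (Subgroup.mem_zpowers x)
    · exact Subgroup.mem_sup_left hb
  · intro y hy z hz
    obtain ⟨a, ha, k, rfl⟩ := (hmem y).1 hy
    obtain ⟨b, hb, l, rfl⟩ := (hmem z).1 hz
    have hab : Commute a b := hA.1 a ha b hb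
    exact ((hab.mul_right (hax a ha l)).mul_left
      ((hax b hb k).symm.mul_right ((Commute.refl x).zpow_zpow k l))).eq
  · intro y hy
    obtain ⟨a, ha, k, rfl⟩ := (hmem y).1 hy
    rw [(hax a ha k).mul_pow, hA.2 a ha, one_mul, ← zpow_natCast, ← zpow_mul, mul_comm k,
      zpow_mul, zpow_natCast, hxp, one_zpow]

theorem eq_one_of_conj_eq_mul_of_coprime {G : Type*} [Group G] {p k m : ℕ} (hm : m.Coprime p)
    {z q v : G} (hz : z ^ m = 1) (hzq : z * q * z⁻¹ = v * q) (hzv : Commute z v)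
    (hv : v ^ p ^ k = 1) : v = 1 := by
  have key : ∀ n : ℕ, z ^ n * q * (z ^ n)⁻¹ = v ^ n * q := by
    intro n
    induction n with
    | zero => simp
    | succ n ih =>
      calc z ^ (n + 1) * q * (z ^ (n + 1))⁻¹ = z ^ n * (z * q * z⁻¹) * (z ^ n)⁻¹ := by
            rw [pow_succ]; group
        _ = (z ^ n * v) * q * (z ^ n)⁻¹ := by rw [hzq]; simp only [mul_assoc]
        _ = v * (z ^ n * q * (z ^ n)⁻¹) := by
            rw [(hzv.pow_left n).eq]; simp only [mul_assoc]
        _ = v ^ (n + 1) * q := by rw [ih, pow_succ']; simp only [mul_assoc]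
  have hvm : v ^ m = 1 := by simpa [hz] using (key m).symm
  rw [← orderOf_eq_one_iff]
  exact Nat.eq_one_of_dvd_coprimes (hm.pow_right k) (orderOf_dvd_of_pow_eq_one hvm)
    (orderOf_dvd_of_pow_eq_one hv)

/-- A `p'`-element acting on a finite `p`-group with `p` odd whose elements of exponent `p` are
central acts trivially if it fixes all the elements of exponent `p`. -/
theorem IsPGroup.commute_of_coprime_of_forall_pow_eq_one {p : ℕ} [Fact p.Prime] (hp : Odd p)
    {G : Type*} [Group G] [Finite G] {D : Subgroup G} (hD : IsPGroup p D) {m : ℕ}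
    (hm : m.Coprime p) {z : G} (hz : z ^ m = 1) (hzD : ∀ d ∈ D, z * d * z⁻¹ ∈ D)
    (hcent : ∀ a ∈ D, a ^ p = 1 → ∀ d ∈ D, Commute a d)
    (hfix : ∀ a ∈ D, a ^ p = 1 → Commute z a) :
    ∀ d ∈ D, Commute z d := by
  have key : ∀ k : ℕ, ∀ d ∈ D, d ^ p ^ k = 1 → Commute z d := by
    intro k
    induction k with
    | zero => intro d _ hd; simp_all
    | succ k ih =>
      intro d hd hdk
      have hdp : Commute z (d ^ p) := ih _ (D.pow_mem hd p) (by rw [← pow_mul, ← pow_succ', hdk])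
      have hy : (d⁻¹ * (z * d * z⁻¹)) ^ p = 1 := by
        have := hD.inv_mul_pow_eq_one hp ⊤
          (fun u _ hup e => Subtype.ext (hcent u u.2 (by simpa using congrArg Subtype.val hup)
            e e.2))
          (x := ⟨d, hd⟩) (y := ⟨_, hzD d hd⟩) (Subgroup.mem_top _)
          (Subtype.ext (by
            simp only [SubmonoidClass.mk_pow, conj_pow]
            rw [hdp.eq, mul_inv_cancel_right]))
        simpa using congrArg Subtype.val this
      have hyD : d⁻¹ * (z * d * z⁻¹) ∈ D := D.mul_mem (D.inv_mem hd) (hzD d hd)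
      have h1 : z * d * z⁻¹ = d⁻¹ * (z * d * z⁻¹) * d := by
        rw [(hcent _ hyD hy d hd).eq, mul_inv_cancel_left]
      have h2 := eq_one_of_conj_eq_mul_of_coprime (k := 1) hm hz h1 (hfix _ hyD hy)
        (by simpa using hy)
      rw [h2, one_mul] at h1
      exact mul_inv_eq_iff_eq_mul.1 h1
  intro d hd
  obtain ⟨k, hk⟩ := hD ⟨d, hd⟩
  exact key k d hd (by simpa using congrArg Subtype.val hk)

/-- A `p'`-element acting on a finite `p`-group `Q` with `p` odd acts trivially if it centralizes a
normal subgroup `A` containing every element of exponent `p` of its centralizer. -/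
theorem IsPGroup.commute_of_coprime_of_commute {p : ℕ} [Fact p.Prime] (hp : Odd p)
    {G : Type*} [Group G] [Finite G] {Q A : Subgroup G} (hQ : IsPGroup p Q)
    (hAn : ∀ q ∈ Q, ∀ a ∈ A, q * a * q⁻¹ ∈ A)
    (hmax : ∀ x ∈ Q, x ∈ Subgroup.centralizer (A : Set G) → x ^ p = 1 → x ∈ A)
    {m : ℕ} (hm : m.Coprime p) {z : G} (hz : z ^ m = 1) (hzQ : ∀ q ∈ Q, z * q * z⁻¹ ∈ Q)
    (hzA : ∀ a ∈ A, Commute z a) : ∀ q ∈ Q, Commute z q := by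
  have hmemC : ∀ x, x ∈ Subgroup.centralizer (A : Set G) ↔ ∀ a ∈ A, Commute a x := fun x =>
    Subgroup.mem_centralizer_iff
  have hz' : ∀ q ∈ Q ⊓ Subgroup.centralizer (A : Set G), Commute z q := by
    refine IsPGroup.commute_of_coprime_of_forall_pow_eq_one hp hQ.to_inf_left hm hz ?_ ?_ ?_
    · rintro d ⟨hdQ, hdA⟩
      refine ⟨hzQ d hdQ, (hmemC _).2 fun a ha => ?_⟩
      have := ((hmemC _).1 hdA a ha)
      exact ((hzA a ha).symm.mul_right this).mul_right (hzA a ha).symm.inv_right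
    · rintro a ⟨haQ, haA⟩ hap d ⟨_, hdA⟩
      exact (hmemC _).1 hdA a (hmax a haQ haA hap)
    · rintro a ⟨haQ, haA⟩ hap
      exact hzA a (hmax a haQ haA hap)
  intro q hq
  set v := z * q * z⁻¹ * q⁻¹ with hv
  have hvQ : v ∈ Q := Q.mul_mem (hzQ q hq) (Q.inv_mem hq)
  have hvA : v ∈ Subgroup.centralizer (A : Set G) := by
    refine (hmemC _).2 fun a ha => ?_
    have h1 : Commute z (q⁻¹ * a * q) := hzA _ (by simpa using hAn q⁻¹ (Q.inv_mem hq) a ha)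
    have h2 : Commute z a := hzA a ha
    have h3 : z⁻¹ * (q⁻¹ * a * q) = q⁻¹ * a * q * z⁻¹ := h1.inv_left.eq
    refine Eq.symm ?_
    calc v * a = z * q * (z⁻¹ * (q⁻¹ * a * q)) * q⁻¹ := by rw [hv]; group
      _ = (z * a) * q * z⁻¹ * q⁻¹ := by rw [h3]; group
      _ = a * v := by rw [h2.eq, hv]; group
  obtain ⟨k, hk⟩ := hQ ⟨v, hvQ⟩
  have h1 : z * q * z⁻¹ = v * q := by rw [hv]; group
  have h2 := eq_one_of_conj_eq_mul_of_coprime hm hz h1 (hz' v ⟨hvQ, hvA⟩)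
    (by simpa using congrArg Subtype.val hk)
  rw [h2, one_mul] at h1
  exact mul_inv_eq_iff_eq_mul.1 h1

theorem Sylow.le_sup_of_forall_pow_mem {p : ℕ} [Fact p.Prime] {G : Type*} [Group G] [Finite G]
    (T : Sylow p G) (K C : Subgroup G) [K.Normal] [C.Normal]
    (hK : ∀ x ∈ K, ∃ k : ℕ, x ^ p ^ k ∈ C) : K ≤ (T : Subgroup G) ⊔ C := by
  have hsurj := QuotientGroup.mk'_surjective C
  have : (K.map (QuotientGroup.mk' C)).Normal := ‹K.Normal›.map _ hsurj
  have hKp : IsPGroup p (K.map (QuotientGroup.mk' C)) := by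
    rintro ⟨_, x, hx, rfl⟩
    obtain ⟨k, hk⟩ := hK x hx
    refine ⟨k, Subtype.ext ?_⟩
    simpa [← map_pow] using (QuotientGroup.eq_one_iff _).2 hk
  have hle := hKp.le_sylow_of_normal (T.mapSurjective hsurj)
  intro x hx
  obtain ⟨t, ht, htx⟩ := hle (Subgroup.mem_map_of_mem _ hx)
  rw [Subgroup.mem_sup_of_normal_right]
  exact ⟨t, ht, t⁻¹ * x, QuotientGroup.eq.1 htx, by simp⟩

theorem IsPGroup.exists_conj_mem_common {p : ℕ} [Fact p.Prime] {G : Type*} [Group G] [Finite G]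
    {K R S : Subgroup G} (hR : IsPGroup p R) (hRK : R ≤ K) (hS : IsPGroup p S) (hSK : S ≤ K) :
    ∃ T ≤ K, IsPGroup p T ∧ R ≤ T ∧ ∃ n ∈ K, ∀ x ∈ S, n * x * n⁻¹ ∈ T := by
  obtain ⟨T, hT⟩ := (hR.comap_subtype (K := K)).exists_le_sylow
  obtain ⟨T', hT'⟩ := (hS.comap_subtype (K := K)).exists_le_sylow
  obtain ⟨n, rfl⟩ := MulAction.exists_smul_eq K T' T
  refine ⟨(↑(n • T') : Subgroup K).map K.subtype, Subgroup.map_subtype_le _, (n • T').2.map _,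
    fun r hr => ⟨⟨r, hRK hr⟩, hT hr, rfl⟩, n, n.2, fun x hx => ⟨n * ⟨x, hSK hx⟩ * n⁻¹, ?_, rfl⟩⟩
  have : (⟨x, hSK hx⟩ : K) ∈ (T' : Subgroup K) := hT' hx
  exact Subgroup.smul_mem_pointwise_smul _ (MulAut.conj n) _ this

theorem IsPGroup.exists_lt_le_normalizing {p : ℕ} [Fact p.Prime] {G : Type*} [Group G] [Finite G]
    {Q T : Subgroup G} (hT : IsPGroup p T) (hQT : Q < T) :
    ∃ R ≤ T, Q < R ∧ R ≤ Subgroup.normalizer (Q : Set G) := by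
  have := hT.isNilpotent
  have hlt : Q.subgroupOf T < ⊤ := lt_top_iff_ne_top.2 fun h =>
    hQT.not_ge (Subgroup.subgroupOf_eq_top.1 h)
  obtain ⟨x, hx, hxQ⟩ := SetLike.exists_of_lt (Group.normalizerCondition_of_isNilpotent _ hlt)
  refine ⟨T ⊓ Subgroup.normalizer (Q : Set G), inf_le_left, ?_, inf_le_right⟩
  refine lt_of_le_not_ge (le_inf hQT.le Subgroup.le_normalizer) fun h => hxQ (h ⟨x.2, ?_⟩)
  refine Subgroup.mem_normalizer_iff.2 fun q => ?_
  have hx' := Subgroup.mem_normalizer_iff.1 hx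
  constructor
  · intro hq
    exact (hx' ⟨q, hQT.le hq⟩).1 hq
  · intro hq
    have hqT : q ∈ T := by
      have := T.mul_mem (T.mul_mem (T.inv_mem x.2) (hQT.le hq)) x.2
      simpa [mul_assoc] using this
    exact (hx' ⟨q, hqT⟩).2 hq

theorem Subgroup.mem_normalizer_of_forall_conj_mem {G : Type*} [Group G] [Finite G]
    {Q : Subgroup G} {g : G} (hg : ∀ x ∈ Q, g * x * g⁻¹ ∈ Q) :
    g ∈ Subgroup.normalizer (Q : Set G) := by
  have hle : Q.map (MulAut.conj g).toMonoidHom ≤ Q := by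
    rintro _ ⟨x, hx, rfl⟩
    exact hg x hx
  have heq := Subgroup.eq_of_le_of_card_ge hle
    (Subgroup.card_map_of_injective (MulAut.conj g).injective).ge
  refine Subgroup.mem_normalizer_iff.2 fun x => ⟨hg x, fun hx => ?_⟩
  rw [← heq] at hx
  obtain ⟨y, hy, hyx⟩ := hx
  have : y = x := (MulAut.conj g).injective hyx
  exact this ▸ hy

theorem Subgroup.normalizer_le_normalizer_centralizer {G : Type*} [Group G] (S : Subgroup G) :
    Subgroup.normalizer (S : Set G) ≤
      Subgroup.normalizer (Subgroup.centralizer (S : Set G) : Set G) := by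
  refine Subgroup.le_normalizer_iff.2 fun g hg z hz => ?_
  rw [Subgroup.mem_centralizer_iff] at hz ⊢
  intro s hs
  have h := hz _ ((Subgroup.mem_normalizer_iff.1 (inv_mem hg) s).1 hs)
  simp only [inv_inv] at h
  calc s * (g * z * g⁻¹) = g * (g⁻¹ * s * g * z) * g⁻¹ := by group
    _ = g * z * g⁻¹ * s := by rw [h]; group

/-- Every conjugation map from `Q` into `H` by an element of `G` is induced by an element of `H`. -/
def Subgroup.ControlsConjugation {G : Type*} [Group G] (H Q : Subgroup G) : Prop :=
  ∀ g : G, (∀ x ∈ Q, g * x * g⁻¹ ∈ H) →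
    ∃ h ∈ H, ∃ z ∈ Subgroup.centralizer (Q : Set G), g = h * z

/-- If `H` controls conjugation on the `p`-subgroups larger than `Q`, then every element of `L`
conjugating `Q` into `H` agrees, up to an element of `H`, with one normalizing `Q`. -/
theorem Sylow.exists_eq_mul_mem_normalizer {p : ℕ} [Fact p.Prime] {G : Type*} [Group G] [Finite G]
    {H : Subgroup G} (P : Sylow p G) (hPH : (P : Subgroup G) ≤ H) {Q L : Subgroup G}
    (hQ : IsPGroup p Q) (hQH : Q ≤ H) (hQL : Q ≤ L)
    (hCL : Subgroup.centralizer (Q : Set G) ≤ L)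
    (hbig : ∀ R : Subgroup G, R ≤ H → IsPGroup p R → Nat.card Q < Nat.card R →
      H.ControlsConjugation R)
    {c : G} (hcL : c ∈ L) (hc : ∀ x ∈ Q, c * x * c⁻¹ ∈ H) :
    ∃ h ∈ H, ∃ n ∈ L ⊓ Subgroup.normalizer (Q : Set G), c = h * n := by
  obtain ⟨T, hTHL, hT, hQT, n, hn, hnT⟩ := hQ.exists_conj_mem_common (K := H ⊓ L) (le_inf hQH hQL)
    (hQ.map (MulAut.conj c).toMonoidHom) (by
      rintro _ ⟨x, hx, rfl⟩
      exact ⟨hc x hx, L.mul_mem (L.mul_mem hcL (hQL hx)) (L.inv_mem hcL)⟩)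
  set e := n * c with he
  have heL : e ∈ L := L.mul_mem hn.2 hcL
  have heT : ∀ x ∈ Q, e * x * e⁻¹ ∈ T := fun x hx => by
    have := hnT (c * x * c⁻¹) ⟨x, hx, rfl⟩
    rw [he]
    simpa [mul_assoc] using this
  suffices hmain : ∃ h ∈ H, ∃ n ∈ L ⊓ Subgroup.normalizer (Q : Set G), e = h * n by
    obtain ⟨h, hh, y, hy, hey⟩ := hmain
    exact ⟨n⁻¹ * h, H.mul_mem (H.inv_mem hn.1) hh, y, hy, by rw [mul_assoc, ← hey, he]; simp⟩
  obtain rfl | hlt := hQT.eq_or_lt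
  · exact ⟨1, H.one_mem, e, ⟨heL, Subgroup.mem_normalizer_of_forall_conj_mem heT⟩, by simp⟩
  set Q' := Q.map (MulAut.conj e).toMonoidHom with hQ'
  have hcard : Nat.card Q' = Nat.card Q := Subgroup.card_map_of_injective (MulAut.conj e).injective
  have hQ'T : Q' < T := by
    refine lt_of_le_of_ne (by rintro _ ⟨x, hx, rfl⟩; exact heT x hx) fun h => ?_
    exact hlt.ne (Subgroup.eq_of_le_of_card_ge hQT (by rw [← hcard, h]))
  have hcardlt : ∀ {A B : Subgroup G}, A < B → Nat.card A < Nat.card B := fun h =>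
    not_le.1 fun h' => h.ne (Subgroup.eq_of_le_of_card_ge h.le h')
  obtain ⟨R, hRT, hQR, hRN⟩ := hT.exists_lt_le_normalizing hlt
  obtain ⟨R', hR'T, hQR', hR'N⟩ := hT.exists_lt_le_normalizing hQ'T
  have hCR : Subgroup.centralizer (R : Set G) ≤ Subgroup.centralizer (Q : Set G) :=
    Subgroup.centralizer_le hQR.le
  have hRp : IsPGroup p R := hT.to_le hRT
  have hR'p : IsPGroup p R' := hT.to_le hR'T
  obtain ⟨S, hSK, hS, hRS, m, hm, hmS⟩ := hRp.exists_conj_mem_common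
    (K := L ⊓ Subgroup.normalizer (Q : Set G)) (le_inf (hRT.trans (hTHL.trans inf_le_right)) hRN)
    (hR'p.map (MulAut.conj e⁻¹).toMonoidHom) (by
      rintro _ ⟨x, hx, rfl⟩
      refine ⟨L.mul_mem (L.mul_mem (L.inv_mem heL) (hTHL (hR'T hx)).2) (by simpa using heL), ?_⟩
      refine Subgroup.mem_normalizer_of_forall_conj_mem fun q hq => ?_
      obtain ⟨y, hy, hyx⟩ := (Subgroup.mem_normalizer_iff.1 (hR'N hx) (e * q * e⁻¹)).1 ⟨q, hq, rfl⟩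
      have hyx' : e * y * e⁻¹ = x * (e * q * e⁻¹) * x⁻¹ := hyx
      have : (MulAut.conj e⁻¹).toMonoidHom x * q * ((MulAut.conj e⁻¹).toMonoidHom x)⁻¹ = y := by
        calc _ = e⁻¹ * (x * (e * q * e⁻¹) * x⁻¹) * e := by simp [mul_assoc]
          _ = y := by rw [← hyx']; group
      rwa [this])
  obtain ⟨P', -, hP', hPP', k, -, hk⟩ := P.2.exists_conj_mem_common le_top hS le_top
  obtain rfl := P.3 hP' hPP'
  have hkH : ∀ x ∈ S, k * x * k⁻¹ ∈ H := fun x hx => hPH (hk x hx)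
  obtain ⟨h₁, hh₁, z₁, hz₁, hk₁⟩ := hbig R (hRT.trans (hTHL.trans inf_le_left)) hRp (hcardlt hQR) k
    fun x hx => hkH x (hRS hx)
  obtain ⟨h₂, hh₂, z₂, hz₂, hk₂⟩ := hbig R' (hR'T.trans (hTHL.trans inf_le_left)) hR'p
    (hcard ▸ hcardlt hQR') (k * m * e⁻¹) fun x hx => by
      have := hkH _ (hmS _ ⟨x, hx, rfl⟩)
      simpa [mul_assoc] using this
  have hw : e⁻¹ * z₂ * e ∈ Subgroup.centralizer (Q : Set G) := by
    refine Subgroup.mem_centralizer_iff.2 fun q hq => ?_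
    have h := Subgroup.mem_centralizer_iff.1 hz₂ (e * q * e⁻¹) (hQR'.le ⟨q, hq, rfl⟩)
    calc q * (e⁻¹ * z₂ * e) = e⁻¹ * (e * q * e⁻¹ * z₂) * e := by group
      _ = e⁻¹ * z₂ * e * q := by rw [h]; group
  have hCN : Subgroup.centralizer (Q : Set G) ≤ L ⊓ Subgroup.normalizer (Q : Set G) :=
    le_inf hCL (Subgroup.centralizer_le_normalizer _)
  refine ⟨h₂⁻¹ * h₁, H.mul_mem (H.inv_mem hh₂) hh₁, z₁ * m * (e⁻¹ * z₂ * e)⁻¹,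
    mul_mem (mul_mem (hCN (hCR hz₁)) hm) (inv_mem (hCN hw)), ?_⟩
  have h3 : h₁ * z₁ * m * e⁻¹ = h₂ * z₂ := by rw [← hk₁, hk₂]
  calc e = h₂⁻¹ * (h₂ * z₂) * z₂⁻¹ * e := by group
    _ = h₂⁻¹ * h₁ * (z₁ * m * (e⁻¹ * z₂ * e)⁻¹) := by rw [← h3]; group

/-- Control of conjugation on elementary abelian `p`-subgroups and on the `p`-subgroups larger
than `Q` implies control of conjugation on `Q`, for `p` odd. -/
theorem Sylow.controlsConjugation_of_forall_card_lt {p : ℕ} [Fact p.Prime] (hp : Odd p)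
    {G : Type*} [Group G] [Finite G] {H : Subgroup G} (P : Sylow p G) (hPH : (P : Subgroup G) ≤ H)
    (helem : ∀ E : Subgroup G, E ≤ H → E.IsElementaryAbelian p → H.ControlsConjugation E)
    {Q : Subgroup G} (hQ : IsPGroup p Q) (hQH : Q ≤ H)
    (hbig : ∀ R : Subgroup G, R ≤ H → IsPGroup p R → Nat.card Q < Nat.card R →
      H.ControlsConjugation R) :
    H.ControlsConjugation Q := by
  have hred := fun {c : G} => P.exists_eq_mul_mem_normalizer hPH (L := ⊤) hQ hQH le_top le_top hbig
    (c := c) (Subgroup.mem_top c)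
  set N := Subgroup.normalizer (Q : Set G) with hN
  have hQN : (Q.subgroupOf N).Normal := Subgroup.normal_in_normalizer
  -- a Sylow `p`-subgroup of the normalizer of `Q` which lies in `H`
  obtain ⟨T, hTH⟩ : ∃ T : Sylow p N, ∀ t ∈ T, (t : G) ∈ H := by
    obtain ⟨T₀⟩ : Nonempty (Sylow p N) := inferInstance
    obtain ⟨P', -, hP', hPP', k, -, hk⟩ :=
      P.2.exists_conj_mem_common le_top (T₀.2.map N.subtype) le_top
    obtain rfl := P.3 hP' hPP'
    have hkH : ∀ t ∈ T₀, k * (t : G) * k⁻¹ ∈ H := fun t ht => hPH (hk t ⟨t, ht, rfl⟩)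
    have hQT₀ : Q.subgroupOf N ≤ T₀ :=
      IsPGroup.le_sylow_of_normal (N := Q.subgroupOf N) (hQ.comap_subtype (K := N)) T₀
    obtain ⟨h, hh, n, hn, rfl⟩ := hred (c := k) fun x hx =>
      hkH ⟨x, Subgroup.le_normalizer hx⟩ (hQT₀ hx)
    refine ⟨(⟨n, hn.2⟩ : N) • T₀, fun t ht => ?_⟩
    obtain ⟨s, hs, rfl⟩ := ht
    have := H.mul_mem (H.mul_mem (H.inv_mem hh) (hkH s hs)) hh
    simpa [mul_assoc] using this
  have hQT : Q.subgroupOf N ≤ T :=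
      IsPGroup.le_sylow_of_normal (N := Q.subgroupOf N) (hQ.comap_subtype (K := N)) T
  -- a maximal elementary abelian subgroup of `Q` normalized by `T`
  obtain ⟨A, hAQ, hTA, hA, hAmax⟩ : ∃ A ≤ Q, (∀ t ∈ T, (t : G) ∈ Subgroup.normalizer (A : Set G)) ∧
      A.IsElementaryAbelian p ∧
      ∀ x ∈ Q, x ∈ Subgroup.centralizer (A : Set G) → x ^ p = 1 → x ∈ A := by
    have hn : ((Q.subgroupOf N).subgroupOf (T : Subgroup N)).Normal := inferInstance
    obtain ⟨B, hBQ, hBn, hB, hBmax⟩ := T.2.exists_isElementaryAbelian_normal hp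
      ((Q.subgroupOf N).subgroupOf (T : Subgroup N))
    refine ⟨(B.map (T : Subgroup N).subtype).map N.subtype, ?_, ?_, ⟨?_, ?_⟩, ?_⟩
    · rintro _ ⟨_, ⟨b, hb, rfl⟩, rfl⟩
      exact hBQ hb
    · intro t ht
      refine Subgroup.mem_normalizer_of_forall_conj_mem ?_
      rintro _ ⟨_, ⟨b, hb, rfl⟩, rfl⟩
      exact ⟨_, ⟨_, hBn.conj_mem b hb ⟨t, ht⟩, rfl⟩, rfl⟩
    · rintro _ ⟨_, ⟨b, hb, rfl⟩, rfl⟩ _ ⟨_, ⟨c, hc, rfl⟩, rfl⟩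
      simpa using congrArg (fun x : (T : Subgroup N) => ((x : N) : G)) (hB.1 b hb c hc)
    · rintro _ ⟨_, ⟨b, hb, rfl⟩, rfl⟩
      simpa using congrArg (fun x : (T : Subgroup N) => ((x : N) : G)) (hB.2 b hb)
    · intro x hx hxc hxp
      refine ⟨_, ⟨⟨⟨x, Subgroup.le_normalizer hx⟩, hQT hx⟩, hBmax _ hx ?_ ?_, rfl⟩, rfl⟩
      · refine Subgroup.mem_centralizer_iff.2 fun b hb => ?_
        exact Subtype.ext (Subtype.ext
          (Subgroup.mem_centralizer_iff.1 hxc _ ⟨_, ⟨b, hb, rfl⟩, rfl⟩))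
      · exact Subtype.ext (Subtype.ext hxp)
  have hQA : Q ≤ Subgroup.normalizer (A : Set G) := fun q hq =>
    hTA ⟨q, Subgroup.le_normalizer hq⟩ (hQT hq)
  -- the centralizer of `A` in the normalizer of `Q`
  have hcent : ∀ z ∈ N, z ∈ Subgroup.centralizer (A : Set G) →
      ∃ h ∈ H ⊓ N, ∃ y ∈ Subgroup.centralizer (Q : Set G), z = h * y := by
    intro z hz hzA
    set M := N ⊓ Subgroup.normalizer (A : Set G) with hM
    have hn₁ : ((Subgroup.centralizer (A : Set G)).subgroupOf M).Normal :=
      Subgroup.normal_subgroupOf_of_le_normalizer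
        (inf_le_right.trans (Subgroup.normalizer_le_normalizer_centralizer A))
    have hn₂ : ((Subgroup.centralizer (Q : Set G)).subgroupOf M).Normal :=
      Subgroup.normal_subgroupOf_of_le_normalizer
        (inf_le_left.trans (Subgroup.normalizer_le_normalizer_centralizer Q))
    have hle := (T.comapOfInjective (Subgroup.inclusion (inf_le_left : M ≤ N))
      (Subgroup.inclusion_injective _)
      (fun t ht => ⟨⟨t, t.2, hTA t ht⟩, rfl⟩)).le_sup_of_forall_pow_mem
      ((Subgroup.centralizer (A : Set G)).subgroupOf M)
      ((Subgroup.centralizer (Q : Set G)).subgroupOf M) (by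
        intro x hx
        obtain ⟨k, m, hm, hkm⟩ := Nat.exists_eq_pow_mul_and_not_dvd (orderOf_pos x).ne' p
          (Fact.out : p.Prime).ne_one
        have hxk : x ^ p ^ k ∈ (Subgroup.centralizer (A : Set G)).subgroupOf M :=
          Subgroup.pow_mem _ hx _
        refine ⟨k, Subgroup.mem_centralizer_iff.2 fun q hq => ?_⟩
        refine (hQ.commute_of_coprime_of_commute hp
          (fun q hq a ha => (Subgroup.mem_normalizer_iff.1 (hQA hq) a).1 ha) hAmax
          ((Fact.out : p.Prime).coprime_iff_not_dvd.2 hm).symm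
          (z := ((x ^ p ^ k : M) : G)) ?_
          (fun q hq => (Subgroup.mem_normalizer_iff.1 (x ^ p ^ k).2.1 q).1 hq)
          (fun a ha => (Subgroup.mem_centralizer_iff.1 hxk a ha).symm) q hq).eq.symm
        rw [← Subgroup.coe_pow, ← pow_mul, ← hkm, pow_orderOf_eq_one, Subgroup.coe_one])
    have hzM : z ∈ M := ⟨hz, Subgroup.centralizer_le_normalizer _ hzA⟩
    obtain ⟨t, ht, y, hy, hty⟩ := Subgroup.mem_sup_of_normal_right.1
      (hle (x := ⟨z, hzM⟩) hzA)
    exact ⟨t, ⟨hTH _ ht, t.2.1⟩, y, hy, (congrArg Subtype.val hty).symm⟩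
  intro g hg
  obtain ⟨h₁, hh₁, g, hgN, rfl⟩ := hred hg
  obtain ⟨h₂, hh₂, c, hc, rfl⟩ := helem A (hAQ.trans hQH) hA g fun a ha =>
    hQH ((Subgroup.mem_normalizer_iff.1 hgN.2 a).1 (hAQ ha))
  have hcH : ∀ x ∈ Q, c * x * c⁻¹ ∈ H := by
    intro x hx
    have := H.mul_mem (H.mul_mem (H.inv_mem hh₂)
      (hQH ((Subgroup.mem_normalizer_iff.1 hgN.2 x).1 hx))) hh₂
    simpa [mul_assoc] using this
  obtain ⟨h₃, hh₃, n, ⟨hnL, hnN⟩, rfl⟩ := P.exists_eq_mul_mem_normalizer hPH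
    (L := Subgroup.centralizer (A : Set G) ⊔ Q) hQ hQH le_sup_right
    ((Subgroup.centralizer_le hAQ).trans le_sup_left) hbig (Subgroup.mem_sup_left hc) hcH
  have hnL' : n ∈ ((Subgroup.centralizer (A : Set G) ⊔ Q : Subgroup G) : Set G) := hnL
  rw [Subgroup.coe_mul_of_right_le_normalizer_left _ _
    (hQA.trans (Subgroup.normalizer_le_normalizer_centralizer A))] at hnL'
  obtain ⟨z, hz, q, hq, rfl⟩ := hnL'
  have hqN : q ∈ N := Subgroup.le_normalizer hq
  obtain ⟨h₄, hh₄, y, hy, rfl⟩ := hcent z ((Subgroup.mul_mem_cancel_right _ hqN).1 hnN) hz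
  refine ⟨h₁ * h₂ * h₃ * h₄ * q, ?_, q⁻¹ * y * q⁻¹⁻¹, ?_, ?_⟩
  · exact H.mul_mem (H.mul_mem (H.mul_mem (H.mul_mem hh₁ hh₂) hh₃) hh₄.1) (hQH hq)
  · exact (Subgroup.mem_normalizer_iff.1 (Subgroup.normalizer_le_normalizer_centralizer Q
      (inv_mem hqN)) y).1 hy
  · simp [mul_assoc]

theorem Sylow.controlsConjugation_of_forall_isElementaryAbelian {p : ℕ} [Fact p.Prime]
    (hp : Odd p) {G : Type*} [Group G] [Finite G] {H : Subgroup G} (P : Sylow p G)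
    (hPH : (P : Subgroup G) ≤ H)
    (helem : ∀ E : Subgroup G, E ≤ H → E.IsElementaryAbelian p → H.ControlsConjugation E)
    {Q : Subgroup G} (hQ : IsPGroup p Q) (hQH : Q ≤ H) : H.ControlsConjugation Q := by
  induction hn : Nat.card G - Nat.card Q using Nat.strong_induction_on generalizing Q with
  | _ n ih =>
  refine P.controlsConjugation_of_forall_card_lt hp hPH helem hQ hQH fun R hRH hR hQR => ?_
  have := Subgroup.card_le_card_group R
  exact ih _ (by omega) hR hRH rfl

/-- Let `p` be an odd prime, `G` a finite group, `H ≤ G` a subgroup and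
`P` a Sylow `p`-subgroup of `G` with `P ≤ H`.  If `H` controls `p`-fusion in `G` on
elementary abelian `p`-subgroups of `P`, then `H` controls `p`-fusion in `G` on all
subgroups of `P`. -/
theorem control_fusion_of_control_fusion_on_elementary_abelian
    (p : ℕ) [Fact p.Prime] (hp : Odd p)
    (G : Type*) [Group G] [Finite G] (H : Subgroup G)
    (P : Sylow p G) (hPH : (P : Subgroup G) ≤ H)
    (helem : ∀ E : Subgroup G, E ≤ (P : Subgroup G) → E.IsElementaryAbelian p →
      ∀ g : G, (∀ x ∈ E, g * x * g⁻¹ ∈ (P : Subgroup G)) →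
        ∃ h ∈ H, ∀ x ∈ E, h * x * h⁻¹ = g * x * g⁻¹) :
    ∀ Q : Subgroup G, Q ≤ (P : Subgroup G) → ∀ g : G,
      (∀ x ∈ Q, g * x * g⁻¹ ∈ (P : Subgroup G)) →
      ∃ h ∈ H, ∀ x ∈ Q, h * x * h⁻¹ = g * x * g⁻¹ := by
  have hconj : ∀ E : Subgroup G, E ≤ H → E.IsElementaryAbelian p → H.ControlsConjugation E := by
    intro E hEH hE g hg
    have hEp : IsPGroup p E := fun x => ⟨1, Subtype.ext (by simpa using hE.2 x x.2)⟩
    have hconj : ∀ S : Subgroup G, S ≤ H → IsPGroup p S →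
        ∃ n ∈ H, ∀ x ∈ S, n * x * n⁻¹ ∈ (P : Subgroup G) := by
      intro S hSH hS
      obtain ⟨P', -, hP', hPP', n, hn, hnS⟩ := P.2.exists_conj_mem_common hPH hS hSH
      obtain rfl := P.3 hP' hPP'
      exact ⟨n, hn, hnS⟩
    obtain ⟨n, hn, hnE⟩ := hconj E hEH hEp
    obtain ⟨m, hm, hmE⟩ := hconj (E.map (MulAut.conj g).toMonoidHom)
      (by rintro _ ⟨x, hx, rfl⟩; exact hg x hx) (hEp.map _)
    obtain ⟨h, hh, hhE⟩ := helem (E.map (MulAut.conj n).toMonoidHom)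
      (by rintro _ ⟨x, hx, rfl⟩; exact hnE x hx)
      ⟨by
        rintro _ ⟨x, hx, rfl⟩ _ ⟨y, hy, rfl⟩
        rw [← map_mul, ← map_mul, hE.1 x hx y hy], by
        rintro _ ⟨x, hx, rfl⟩
        rw [← map_pow, hE.2 x hx, map_one]⟩ (m * g * n⁻¹) (by
        rintro _ ⟨x, hx, rfl⟩
        have := hmE _ ⟨x, hx, rfl⟩
        simpa [mul_assoc] using this)
    refine ⟨m⁻¹ * h * n, H.mul_mem (H.mul_mem (H.inv_mem hm) hh) hn, (m⁻¹ * h * n)⁻¹ * g,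
      Subgroup.mem_centralizer_iff.2 fun x hx => ?_, by group⟩
    have h1 : h * (n * x * n⁻¹) * h⁻¹ = m * g * n⁻¹ * (n * x * n⁻¹) * (m * g * n⁻¹)⁻¹ :=
      hhE _ ⟨x, hx, rfl⟩
    calc x * ((m⁻¹ * h * n)⁻¹ * g)
        = n⁻¹ * h⁻¹ * (h * (n * x * n⁻¹) * h⁻¹) * m * g := by group
      _ = (m⁻¹ * h * n)⁻¹ * g * x := by rw [h1]; group
  intro Q hQP g hg
  obtain ⟨h, hh, z, hz, rfl⟩ := P.controlsConjugation_of_forall_isElementaryAbelian hp hPH hconj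
    (P.2.to_le hQP) (hQP.trans hPH) g fun x hx => hPH (hg x hx)
  refine ⟨h, hh, fun x hx => ?_⟩
  have hzx := Subgroup.mem_centralizer_iff.1 hz x hx
  calc h * x * h⁻¹ = h * (x * z) * z⁻¹ * h⁻¹ := by group
    _ = h * z * x * (h * z)⁻¹ := by rw [hzx]; group
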